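/- arXiv:1702.02899 — 4 statements merged into one kernel-verified Lean document; each statement's English description precedes it below -/
import Mathlib

section
/- Let α be an automorphism of a finite group G whose order is coprime to |G|, and let N be an α-invariant normal subgroup of G. Then the fixed points of the induced automorphism on G/N equal the image of the fixed-point subgroup: C_{G/N}(α) = C_G(α)N/N. -/
theorem fixed_aux {G : Type*} [Group G] [Finite G] (α : MulAut G) (N : Subgroup G)
    (hN : ∀ x ∈ N, α x ∈ N) (n : ℕ) :
    n.Coprime (Nat.card G) → n ≠ 0 → ∀ (H : Subgroup G), (∀ h ∈ H, α h ∈ H) →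
    (∀ h ∈ H, (α ^ n) h = h) → ∀ g ∈ H, g⁻¹ * α g ∈ N →
    ∃ h ∈ H, α h = h ∧ g⁻¹ * h ∈ N := by
  induction n using induction_on_primes with
  | zero => intro _ h; exact absurd rfl h
  | one =>
    intro _ _ H _ h1 g hg _
    exact ⟨g, hg, by simpa using h1 g hg, by simp [N.one_mem]⟩
  | prime_mul p m hp ih =>
    intro hc hn H hH hfix g hg hgN
    have hα : ∀ s, s ∈ H ∧ g⁻¹ * s ∈ N → α s ∈ H ∧ g⁻¹ * α s ∈ N := by
      rintro s ⟨h1, h2⟩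
      refine ⟨hH s h1, ?_⟩
      have := N.mul_mem hgN (hN _ h2)
      simpa [mul_assoc] using this
    have hpow : ∀ k : ℕ, ∀ s, s ∈ H ∧ g⁻¹ * s ∈ N → (α ^ k) s ∈ H ∧ g⁻¹ * (α ^ k) s ∈ N := by
      intro k
      induction k with
      | zero => intro s hs; simpa using hs
      | succ k ihk =>
        intro s hs
        rw [pow_succ']
        exact hα _ (ihk s hs)
    let S := {s : G // s ∈ H ∧ g⁻¹ * s ∈ N}
    let f : S → S := fun s => ⟨(α ^ m) s.1, hpow m s.1 s.2⟩
    have hf : Function.Injective f := by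
      intro a b hab
      apply Subtype.ext
      exact (α ^ m).injective (congrArg Subtype.val hab)
    let σ : Equiv.Perm S := Equiv.ofBijective f (Finite.injective_iff_bijective.1 hf)
    have hσk : ∀ k : ℕ, ∀ s : S, ((σ ^ k) s).1 = (α ^ (k * m)) s.1 := by
      intro k
      induction k with
      | zero => intro s; simp
      | succ k ihk =>
        intro s
        rw [pow_succ', Nat.succ_mul, Nat.add_comm, pow_add]
        change (α ^ m) ((σ ^ k) s).1 = (α ^ m) ((α ^ (k * m)) s.1)
        rw [ihk]
    have hσ : σ ^ p ^ 1 = 1 := by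
      ext s
      rw [hσk, pow_one]
      exact hfix _ s.2.1
    let e : S ≃ (H ⊓ N : Subgroup G) :=
      { toFun := fun s => ⟨g⁻¹ * s.1, H.mul_mem (H.inv_mem hg) s.2.1, s.2.2⟩
        invFun := fun t => ⟨g * t.1, H.mul_mem hg t.2.1, by simpa using t.2.2⟩
        left_inv := fun s => by simp
        right_inv := fun t => by simp }
    have hcp : p.Coprime (Nat.card G) := Nat.Coprime.coprime_mul_right hc
    have hcard : ¬ p ∣ Nat.card S := by
      rw [Nat.card_congr e]
      intro hd
      exact (hp.coprime_iff_not_dvd.1 hcp) (hd.trans (Subgroup.card_subgroup_dvd_card _))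
    haveI := Fact.mk hp
    haveI := Fintype.ofFinite S
    rw [Nat.card_eq_fintype_card] at hcard
    obtain ⟨s, hs⟩ := Equiv.Perm.exists_fixed_point_of_prime hcard hσ
    have hs' : (α ^ m) s.1 = s.1 := congrArg Subtype.val hs
    let H' : Subgroup G := H ⊓ (α ^ m).toMonoidHom.eqLocus (MonoidHom.id G)
    have hH' : ∀ x, x ∈ H' ↔ x ∈ H ∧ (α ^ m) x = x := fun x => Iff.rfl
    obtain ⟨h, h1, h2, h3⟩ := ih (Nat.Coprime.coprime_mul_left hc)
      (by rintro rfl; simp at hn) H'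
      (by
        intro h hh
        rw [hH'] at hh ⊢
        refine ⟨hH _ hh.1, ?_⟩
        change (α ^ m * α) h = α h
        rw [← pow_succ, pow_succ']
        exact congrArg α hh.2)
      (fun h hh => hh.2) s.1 ⟨s.2.1, hs'⟩
      (by
        have := N.mul_mem (N.inv_mem s.2.2) (hα _ s.2).2
        simpa [mul_assoc] using this)
    refine ⟨h, h1.1, h2, ?_⟩
    have := N.mul_mem s.2.2 h3
    simpa [mul_assoc] using this

/-- For a coprime automorphism `α` of a finite group `G` and an `α`-invariant
normal subgroup `N`, the fixed points of the induced automorphism on `G ⧸ N`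
are exactly the images of fixed points of `α`: `C_{G/N}(α) = C_G(α)N/N`. -/
theorem coprime_automorphism_fixedPoints_quotient (G : Type*) [Group G] [Finite G]
    (α : G ≃* G) (hcop : Nat.Coprime (orderOf α) (Nat.card G))
    (N : Subgroup G) [N.Normal] (hN : N ≤ N.comap α.toMonoidHom) :
    ∀ x : G ⧸ N, QuotientGroup.map N N α.toMonoidHom hN x = x ↔
      ∃ g : G, α g = g ∧ (g : G ⧸ N) = x := by
  intro x
  constructor
  · induction x using QuotientGroup.induction_on with
    | H g =>
      intro h
      have h' : ((α g : G) : G ⧸ N) = g := h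
      have : Finite (MulAut G) := Finite.of_injective (fun a : MulAut G => (a : G → G))
        DFunLike.coe_injective
      have hpos : orderOf (α : MulAut G) ≠ 0 := (orderOf_pos (α : MulAut G)).ne'
      obtain ⟨y, -, hy, hyN⟩ := fixed_aux α N (fun x hx => hN hx) _ hcop hpos ⊤
        (fun _ _ => trivial) (fun h _ => by rw [pow_orderOf_eq_one]; rfl) g trivial
        (QuotientGroup.eq.1 h'.symm)
      exact ⟨y, hy, (QuotientGroup.eq.2 hyN).symm⟩
  · rintro ⟨g, hg, rfl⟩
    change ((α g : G) : G ⧸ N) = g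
    rw [hg]
end

section
/- Let A be a finite noncyclic abelian group acting on a finite group G with gcd(|A|,|G|) = 1. Then G is generated by the subgroups C_G(B), where B ranges over subgroups of A such that A/B is cyclic. -/
set_option linter.style.haveILetI false

universe u v

/-- Every subgroup containing all `C_G(B)` with `A/B` cyclic is everything. -/
def GenBy (A : Type u) (G : Type v) [CommGroup A] [Group G] [MulDistribMulAction A G] : Prop :=
  ∀ H : Subgroup G, (∀ B : Subgroup A, IsCyclic (A ⧸ B) → ∀ g : G, (∀ b ∈ B, b • g = g) → g ∈ H) →
    ∀ g : G, g ∈ H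

/-- Action on an invariant subgroup. -/
@[reducible] def invAct {A : Type u} {G : Type v} [Group A] [Group G] [MulDistribMulAction A G]
    (N : Subgroup G) (h : ∀ (a : A), ∀ g ∈ N, a • g ∈ N) : MulDistribMulAction A N where
  smul a n := ⟨a • (n : G), h a n n.2⟩
  one_smul n := Subtype.ext (one_smul A (n : G))
  mul_smul a b n := Subtype.ext (mul_smul a b (n : G))
  smul_mul a m n := Subtype.ext (smul_mul' a (m : G) (n : G))
  smul_one a := Subtype.ext (smul_one a)

/-- Action on the quotient by an invariant normal subgroup. -/
@[reducible] def quotAct {A : Type u} {G : Type v} [Group A] [Group G] [MulDistribMulAction A G]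
    (N : Subgroup G) [N.Normal] (h : ∀ (a : A), ∀ g ∈ N, a • g ∈ N) :
    MulDistribMulAction A (G ⧸ N) where
  smul a := QuotientGroup.map N N (MulDistribMulAction.toMonoidHom G a) (fun g hg => h a g hg)
  one_smul x := by
    induction x using QuotientGroup.induction_on with
    | H x => exact congrArg (QuotientGroup.mk (s := N)) (one_smul A x)
  mul_smul a b x := by
    induction x using QuotientGroup.induction_on with
    | H x => exact congrArg (QuotientGroup.mk (s := N)) (mul_smul a b x)
  smul_mul a x y := map_mul _ x y
  smul_one a := map_one _

theorem GenBy.le {A : Type u} {G : Type v} [CommGroup A] [Group G] [MulDistribMulAction A G]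
    (N : Subgroup G) (h : ∀ (a : A), ∀ g ∈ N, a • g ∈ N)
    (hN : @GenBy A N _ _ (invAct N h)) (H : Subgroup G)
    (hH : ∀ B : Subgroup A, IsCyclic (A ⧸ B) → ∀ g ∈ N, (∀ b ∈ B, b • g = g) → g ∈ H) :
    N ≤ H := by
  intro g hg
  letI := invAct N h
  have := hN (H.subgroupOf N) (fun B hB n hn => by
    rw [Subgroup.mem_subgroupOf]
    exact hH B hB n n.2 (fun b hb => congrArg Subtype.val (hn b hb))) ⟨g, hg⟩
  exact Subgroup.mem_subgroupOf.1 this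

theorem lift_fixed {q : ℕ} [Fact q.Prime] {B : Type u} {G : Type v} [Group B] [Group G] [Finite G]
    (hB : IsPGroup q B) (hq : ¬ q ∣ Nat.card G)
    [MulDistribMulAction B G] (N : Subgroup G) (g : G)
    (hN : ∀ (a : B), ∀ g ∈ N, a • g ∈ N)
    (hg : ∀ b : B, g⁻¹ * (b • g) ∈ N) :
    ∃ x : G, g⁻¹ * x ∈ N ∧ ∀ b : B, b • x = x := by
  let X := {x : G // g⁻¹ * x ∈ N}
  let e : X ≃ N :=
    { toFun := fun x => ⟨g⁻¹ * x.1, x.2⟩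
      invFun := fun n => ⟨g * n.1, by simp⟩
      left_inv := fun x => by simp
      right_inv := fun x => by simp }
  letI : MulAction B X :=
    { smul := fun b x => ⟨b • x.1, by
        have h1 := N.mul_mem (hg b) (hN b _ x.2)
        simpa [smul_mul', smul_inv', mul_assoc] using h1⟩
      one_smul := fun x => Subtype.ext (one_smul B x.1)
      mul_smul := fun a b x => Subtype.ext (mul_smul a b x.1) }
  obtain ⟨x, hx⟩ := hB.nonempty_fixed_point_of_prime_not_dvd_card X (by
    rw [Nat.card_congr e]
    exact fun h => hq (h.trans N.card_subgroup_dvd_card))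
  exact ⟨x.1, x.2, fun b => congrArg Subtype.val (hx b)⟩

theorem simple_case {A : Type u} {G : Type v} [CommGroup A] [Finite A] [CommGroup G] [Nontrivial G]
    [MulDistribMulAction A G]
    (hs : ∀ N : Subgroup G, (∀ (a : A), ∀ g ∈ N, a • g ∈ N) → N = ⊥ ∨ N = ⊤) :
    ∃ B : Subgroup A, IsCyclic (A ⧸ B) ∧ ∀ b ∈ B, ∀ g : G, b • g = g := by
  let ρ : A →* Module.End ℤ (Additive G) :=
    { toFun := fun a => (MonoidHom.toAdditive (MulDistribMulAction.toMonoidHom G a)).toIntLinearMap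
      map_one' := by ext x; exact one_smul A (Additive.toMul x)
      map_mul' := fun a b => by ext x; exact mul_smul a b (Additive.toMul x) }
  let S := MonoidAlgebra ℤ A
  let F : S →+* Module.End ℤ (Additive G) := (MonoidAlgebra.lift ℤ (Module.End ℤ (Additive G)) A ρ : S →+* _)
  letI : Module S (Additive G) := Module.compHom (Additive G) F
  have hof : ∀ (a : A) (x : Additive G), (MonoidAlgebra.of ℤ A a : S) • x
      = Additive.ofMul (a • Additive.toMul x) := by
    intro a x
    change (MonoidAlgebra.lift ℤ (Module.End ℤ (Additive G)) A ρ (MonoidAlgebra.of ℤ A a)) x = _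
    rw [MonoidAlgebra.lift_of]
    rfl
  haveI : IsSimpleModule S (Additive G) := by
    refine @IsSimpleModule.mk _ _ _ _ _ ?_
    refine @IsSimpleOrder.mk _ _ _ inferInstance ?_
    intro M
    rcases hs (AddSubgroup.toSubgroup' M.toAddSubgroup) (fun a g hg => by
      have := M.smul_mem (MonoidAlgebra.of ℤ A a : S) (x := Additive.ofMul g) hg
      rw [hof] at this
      exact this) with h | h
    · left
      rw [eq_bot_iff]
      intro x hx
      have : Additive.toMul x ∈ (AddSubgroup.toSubgroup' M.toAddSubgroup) := hx
      rw [h, Subgroup.mem_bot] at this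
      exact this
    · right
      rw [eq_top_iff]
      intro x _
      have : Additive.toMul x ∈ (AddSubgroup.toSubgroup' M.toAddSubgroup) := by
        rw [h]; trivial
      exact this
  obtain ⟨I, hI, ⟨e⟩⟩ := isSimpleModule_iff_quot_maximal.1 this
  let f : A →* (S ⧸ I) := (Ideal.Quotient.mk I : S →* S ⧸ I).comp (MonoidAlgebra.of ℤ A)
  letI := Ideal.Quotient.field I
  refine ⟨f.toHomUnits.ker, ?_, ?_⟩
  · exact isCyclic_of_injective_ringHom ((Units.coeHom (S ⧸ I)).comp (QuotientGroup.kerLift f.toHomUnits))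
      (fun x y hxy => QuotientGroup.kerLift_injective _ (Units.ext hxy))
  · intro b hb g
    have h1 : f b = 1 := congrArg Units.val (MonoidHom.mem_ker.1 hb)
    have h2 : (MonoidAlgebra.of ℤ A b : S) • (Additive.ofMul g) = Additive.ofMul g := by
      apply e.injective
      rw [map_smul]
      rw [Algebra.smul_def]
      change f b * _ = _
      rw [h1, one_mul]
    rw [hof] at h2
    exact h2

theorem gen_of_normal {q : ℕ} [Fact q.Prime] {A : Type u} {G : Type v} [CommGroup A] [Group G]
    [Finite G] (hA : IsPGroup q A) (hq : ¬ q ∣ Nat.card G) [MulDistribMulAction A G]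
    (N : Subgroup G) [N.Normal] (h : ∀ (a : A), ∀ g ∈ N, a • g ∈ N)
    (h1 : @GenBy A N _ _ (invAct N h)) (h2 : @GenBy A (G ⧸ N) _ _ (quotAct N h)) : GenBy A G := by
  intro H hH g
  have hNH : N ≤ H := h1.le N h H (fun B hB g _ => hH B hB g)
  letI := quotAct N h
  have := h2 (H.map (QuotientGroup.mk' N)) (fun B hB x => by
    induction x using QuotientGroup.induction_on with
    | H x =>
      intro hx
      obtain ⟨y, hy, hy2⟩ := lift_fixed (hA.to_subgroup B) hq N x (fun b => h b) (fun b => by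
        have := hx b b.2
        exact QuotientGroup.eq.1 this.symm)
      refine ⟨y, hH B hB y (fun b hb => hy2 ⟨b, hb⟩), ?_⟩
      exact (QuotientGroup.eq.2 hy).symm) (QuotientGroup.mk g)
  obtain ⟨y, hy, hyg⟩ := this
  have : y⁻¹ * g ∈ N := QuotientGroup.eq.1 hyg
  simpa using H.mul_mem hy (hNH this)

open scoped Pointwise in
theorem gen_pgroup {q : ℕ} [Fact q.Prime] {A : Type u} [CommGroup A] [Finite A]
    (hA : IsPGroup q A) (n : ℕ) : ∀ (G : Type v) [Group G] [Finite G] [MulDistribMulAction A G],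
    Nat.card G = n → ¬ q ∣ Nat.card G → GenBy A G := by
  induction n using Nat.strong_induction_on with
  | _ n ih =>
  intro G _ _ _ hn hq
  have hlt : ∀ N : Subgroup G, N ≠ ⊤ → ∀ h : (∀ (a : A), ∀ g ∈ N, a • g ∈ N),
      @GenBy A N _ _ (invAct N h) := by
    intro N hN h
    letI := invAct N h
    refine ih (Nat.card N) ?_ N rfl (fun hd => hq (hd.trans N.card_subgroup_dvd_card))
    rw [← hn]
    exact lt_of_le_of_ne (Subgroup.card_le_card_group N) (fun hc => hN (Subgroup.eq_top_of_card_eq N hc))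
  have hnorm : ∀ N : Subgroup G, N.Normal → N ≠ ⊥ → N ≠ ⊤ →
      (∀ (a : A), ∀ g ∈ N, a • g ∈ N) → GenBy A G := by
    intro N _ hb ht h
    refine gen_of_normal hA hq N h (hlt N ht h) ?_
    letI := quotAct N h
    have hc := N.card_mul_index
    rw [Subgroup.index] at hc
    refine ih (Nat.card (G ⧸ N)) ?_ (G ⧸ N) rfl
      (fun hd => hq (hd.trans (Dvd.intro_left _ hc)))
    have h1 : 1 < Nat.card N := (Subgroup.one_lt_card_iff_ne_bot N).2 hb
    have h2 : 0 < Nat.card (G ⧸ N) := Nat.card_pos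
    nlinarith
  rcases subsingleton_or_nontrivial G with hG | hG
  · intro H _ g
    rw [Subsingleton.elim g 1]
    exact H.one_mem
  by_cases hp : ∃ p : ℕ, p.Prime ∧ IsPGroup p G
  · obtain ⟨p, hp, hpG⟩ := hp
    haveI : Fact p.Prime := ⟨hp⟩
    have hc : Subgroup.center G ≠ ⊥ := hpG.bot_lt_center.ne'
    by_cases ht : Subgroup.center G = ⊤
    · letI : CommGroup G := { ‹Group G› with
        mul_comm := fun a b => by
          have : b ∈ Subgroup.center G := by rw [ht]; trivial
          exact Subgroup.mem_center_iff.1 this a }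
      by_cases hs : ∀ N : Subgroup G, (∀ (a : A), ∀ g ∈ N, a • g ∈ N) → N = ⊥ ∨ N = ⊤
      · obtain ⟨B, hB, hBg⟩ := simple_case hs
        exact fun H hH g => hH B hB g (fun b hb => hBg b hb g)
      · push Not at hs
        obtain ⟨N, h, h1, h2⟩ := hs
        exact hnorm N inferInstance h1 h2 h
    · refine hnorm _ inferInstance hc ht ?_
      intro a g hg
      rw [Subgroup.mem_center_iff] at hg ⊢
      intro x
      have := congrArg (fun y => a • y) (hg (a⁻¹ • x))
      simpa [smul_mul'] using this
  · intro H hH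
    have key : ∀ p : ℕ, p.Prime → ¬ p ∣ H.index := by
      intro p hpp hd
      haveI : Fact p.Prime := ⟨hpp⟩
      obtain ⟨P, hP⟩ := hA.nonempty_fixed_point_of_prime_not_dvd_card (Sylow p G) (fun hd =>
        hq ((hd.trans ((default : Sylow p G).card_dvd_index)).trans (Subgroup.index_dvd_card _)))
      have hinv : ∀ (a : A), ∀ g ∈ (P : Subgroup G), a • g ∈ (P : Subgroup G) := by
        intro a g hg
        have h1 : a • (P : Subgroup G) = P := by
          rw [← Sylow.pointwise_smul_def, hP a]
        rw [← h1]
        exact Subgroup.smul_mem_pointwise_smul g a _ hg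
      have hPt : (P : Subgroup G) ≠ ⊤ := by
        intro ht
        refine hp ⟨p, hpp, ?_⟩
        have := P.isPGroup'
        rw [ht] at this
        exact this.of_equiv Subgroup.topEquiv
      have hle := (hlt P hPt hinv).le P hinv H (fun B hB g _ => hH B hB g)
      exact P.not_dvd_index (hd.trans (Subgroup.index_dvd_of_le hle))
    have h1 : H.index = 1 := Nat.eq_one_iff_not_exists_prime_dvd.2 key
    rw [Subgroup.index_eq_one.1 h1]
    intro g; trivial

theorem cyclic_join {A : Type u} [CommGroup A] (Q R : Subgroup A)
    (hQR : Q ⊔ R = ⊤) (hc : (Nat.card Q).Coprime (Nat.card R))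
    (B : Subgroup Q) (D : Subgroup R) (hB : IsCyclic (Q ⧸ B)) (hD : IsCyclic (R ⧸ D)) :
    IsCyclic (A ⧸ (B.map Q.subtype ⊔ D.map R.subtype)) := by
  set E := B.map Q.subtype ⊔ D.map R.subtype with hE
  let f : Q ⧸ B →* A ⧸ E := QuotientGroup.map B E Q.subtype (fun b hb =>
    (le_sup_left : _ ≤ E) (Subgroup.mem_map_of_mem _ hb))
  let k : R ⧸ D →* A ⧸ E := QuotientGroup.map D E R.subtype (fun b hb =>
    (le_sup_right : _ ≤ E) (Subgroup.mem_map_of_mem _ hb))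
  haveI : IsCyclic ((Q ⧸ B) × (R ⧸ D)) := Group.isCyclic_prod_iff.2 ⟨hB, hD,
    (hc.coprime_dvd_left (Subgroup.card_quotient_dvd_card B)).coprime_dvd_right
      (Subgroup.card_quotient_dvd_card D)⟩
  refine isCyclic_of_surjective (f.coprod k) ?_
  intro x
  induction x using QuotientGroup.induction_on with
  | H x =>
    have : x ∈ Q ⊔ R := by rw [hQR]; trivial
    obtain ⟨y, hy, z, hz, rfl⟩ := Subgroup.mem_sup.1 this
    exact ⟨(QuotientGroup.mk ⟨y, hy⟩, QuotientGroup.mk ⟨z, hz⟩), rfl⟩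

theorem gen_all (n : ℕ) : ∀ (A : Type u) [CommGroup A] [Finite A] (G : Type v) [Group G] [Finite G]
    [MulDistribMulAction A G], Nat.card A = n → (Nat.card A).Coprime (Nat.card G) → GenBy A G := by
  induction n using Nat.strong_induction_on with
  | _ n ih =>
  intro A _ _ G _ _ _ hn hcop
  by_cases h1 : Nat.card A = 1
  · haveI : Subsingleton A := (Nat.card_eq_one_iff_unique.1 h1).1
    intro H hH g
    refine hH ⊥ inferInstance g (fun b hb => ?_)
    rw [Subgroup.mem_bot.1 hb, one_smul]
  obtain ⟨q, hq, hqA⟩ := Nat.exists_prime_and_dvd h1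
  haveI : Fact q.Prime := ⟨hq⟩
  let Q : Sylow q A := default
  obtain ⟨R, hR⟩ := Subgroup.exists_right_complement'_of_coprime (N := (Q : Subgroup A))
    Q.card_coprime_index
  have hcard := hR.card_mul_card
  have hidx : (Q : Subgroup A).index = Nat.card R := by
    have := (Q : Subgroup A).card_mul_index
    rw [← hcard] at this
    exact Nat.eq_of_mul_eq_mul_left Nat.card_pos this
  have hcQR : (Nat.card Q).Coprime (Nat.card R) := hidx ▸ Q.card_coprime_index
  have hqG : ¬ q ∣ Nat.card G := fun h =>
    hq.one_lt.ne' (Nat.eq_one_of_dvd_coprimes hcop hqA h)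
  have hQ1 : 1 < Nat.card Q := (Subgroup.one_lt_card_iff_ne_bot _).2 (Q.ne_bot_of_dvd_card hqA)
  have hRlt : Nat.card R < n := by
    have : 0 < Nat.card R := Nat.card_pos
    rw [← hn, ← hcard]; nlinarith
  intro H hH
  refine gen_pgroup (A := (Q : Subgroup A)) Q.isPGroup' _ G rfl hqG H ?_
  intro B hB
  let C : Subgroup G :=
    { carrier := {g | ∀ b ∈ B, b • g = g}
      one_mem' := fun b _ => smul_one b
      mul_mem' := fun {x y} hx hy b hb => by rw [smul_mul', hx b hb, hy b hb]
      inv_mem' := fun {x} hx b hb => by rw [smul_inv', hx b hb] }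
  have hC : ∀ (a : R), ∀ g ∈ C, a • g ∈ C := by
    intro a g hg b hb
    change (b : A) • (a : A) • g = (a : A) • g
    rw [smul_smul, mul_comm, ← smul_smul]
    exact congrArg _ (hg b hb)
  have hle : C ≤ H := by
    letI := invAct C hC
    refine GenBy.le C hC (ih _ hRlt R C rfl ?_) H ?_
    · exact (hcop.coprime_dvd_left R.card_subgroup_dvd_card).coprime_dvd_right
        C.card_subgroup_dvd_card
    · intro D hD g hg hDg
      refine hH _ (cyclic_join (Q : Subgroup A) R hR.sup_eq_top hcQR B D hB hD) g ?_
      intro b hb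
      obtain ⟨y, ⟨y', hy, rfl⟩, z, ⟨z', hz, rfl⟩, rfl⟩ := Subgroup.mem_sup.1 hb
      rw [mul_smul]
      have e1 : (z' : A) • g = g := hDg z' hz
      have e2 : (y' : A) • g = g := hg y' hy
      exact (congrArg _ e1).trans e2
  exact fun g hg => hle hg

/-- A finite noncyclic abelian group `A` acting coprimely on a finite group `G`:
`G` is generated by the fixed-point subgroups `C_G(B)` over subgroups `B ≤ A`
with `A ⧸ B` cyclic. -/
theorem coprime_action_generated_by_centralizers_of_cyclic_quotients
    (A : Type*) [CommGroup A] [Finite A] (hA : ¬ IsCyclic A)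
    (G : Type*) [Group G] [Finite G] [MulDistribMulAction A G]
    (hcop : Nat.Coprime (Nat.card A) (Nat.card G)) :
    Subgroup.closure
      (⋃ B ∈ {B : Subgroup A | IsCyclic (A ⧸ B)}, {g : G | ∀ b ∈ B, b • g = g}) = ⊤ := by
  rw [eq_top_iff]
  intro g _
  refine gen_all _ A G rfl hcop _ ?_ g
  intro B hB g hg
  exact Subgroup.subset_closure (Set.mem_biUnion (show B ∈ {B : Subgroup A | IsCyclic (A ⧸ B)} from hB) hg)
end

section
/- Let q be a prime and A an elementary abelian q-group of order q^2 acting on a finite group G with gcd(q,|G|) = 1. Then G is generated by the centralizers C_G(a) as a ranges over the nontrivial elements of A. -/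
open scoped Pointwise

/-- Coprime lifting of fixed points along an equivariant homomorphism. -/
theorem cop_fixed_lift {q : ℕ} (hq : q.Prime) {A : Type*} [Group A] (hA : IsPGroup q A)
    {G : Type*} [Group G] [Finite G] [MulDistribMulAction A G] (hcop : Nat.Coprime q (Nat.card G))
    {V : Type*} [Group V] [MulDistribMulAction A V] (f : G →* V)
    (hf : ∀ (a : A) (g : G), f (a • g) = a • f g) (a : A) (g : G) (h : a • f g = f g) :
    ∃ g' : G, f g' = f g ∧ a • g' = g' := by
  have : Fact q.Prime := ⟨hq⟩
  let S : SubMulAction (Subgroup.zpowers a) G :=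
    { carrier := f ⁻¹' {f g}
      smul_mem' := by
        rintro ⟨b, hb⟩ x hx
        have hx' : f x = f g := hx
        have hle : Subgroup.zpowers a ≤ MulAction.stabilizer A (f g) := by
          rw [Subgroup.zpowers_le]; exact h
        have hb' : b • f g = f g := hle hb
        change f (b • x) = f g
        rw [hf, hx', hb'] }
  have hcard : Nat.card S = Nat.card f.ker := Nat.card_congr (f.fiberEquivKer g)
  have hnd : ¬ q ∣ Nat.card S := by
    rw [hcard]
    intro hd
    exact (Nat.Prime.coprime_iff_not_dvd hq).1 hcop (hd.trans (Subgroup.card_subgroup_dvd_card _))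
  obtain ⟨x, hx⟩ :=
    (hA.to_subgroup (Subgroup.zpowers a)).nonempty_fixed_point_of_prime_not_dvd_card S hnd
  refine ⟨x.1, x.2, ?_⟩
  have := hx ⟨a, Subgroup.mem_zpowers a⟩
  exact congrArg Subtype.val this

/-- The abelian case. -/
theorem cop_abelian {q : ℕ} (hq : q.Prime) {A : Type*} [Group A]
    (e : A ≃* Multiplicative (ZMod q × ZMod q))
    {V : Type*} [CommGroup V] [MulDistribMulAction A V] (H : Subgroup V)
    (hH : ∀ (a : A) (v : V), a ≠ 1 → a • v = v → v ∈ H) (v : V) : v ^ q ∈ H := by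
  have : Fact q.Prime := ⟨hq⟩
  let τ : ZMod q × ZMod q → A := fun x => e.symm (Multiplicative.ofAdd x)
  have τadd : ∀ x y, τ (x + y) = τ x * τ y := fun x y => by simp [τ]
  have τ0 : τ 0 = 1 := by simp [τ]
  have τne : ∀ x, x ≠ 0 → τ x ≠ 1 := by
    intro x hx h
    apply hx
    have : Multiplicative.ofAdd x = 1 := by simpa [τ] using h
    simpa using this
  -- norms along lines
  have h1 : ∀ t : ZMod q, (∏ s : ZMod q, τ (s, s * t) • v) ∈ H := by
    intro t
    apply hH (τ (1, t)) _ (τne _ (by simp))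
    rw [Finset.smul_prod']
    refine Fintype.prod_equiv (Equiv.addLeft 1) _ _ fun s => ?_
    rw [← mul_smul, ← τadd]
    congr 2
    simp [add_mul]
  have h2 : ∀ s : ZMod q, (∏ r : ZMod q, τ (s, r) • v) ∈ H := by
    intro s
    apply hH (τ (0, 1)) _ (τne _ (by simp))
    rw [Finset.smul_prod']
    refine Fintype.prod_equiv (Equiv.addLeft 1) _ _ fun r => ?_
    rw [← mul_smul, ← τadd]
    congr 2
    simp
  have h3 : (∏ t : ZMod q, ∏ s : ZMod q, τ (s, s * t) • v) =
      v ^ q * ∏ s ∈ Finset.univ.erase (0 : ZMod q), ∏ r : ZMod q, τ (s, r) • v := by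
    rw [Finset.prod_comm, ← Finset.mul_prod_erase Finset.univ _ (Finset.mem_univ (0 : ZMod q))]
    congr 1
    · have : ∀ t : ZMod q, τ (0, 0 * t) • v = v := by
        intro t
        rw [zero_mul]
        change τ 0 • v = v
        rw [τ0, one_smul]
      simp only [this]
      simp [ZMod.card]
    · refine Finset.prod_congr rfl fun s hs => ?_
      have hs0 : s ≠ 0 := Finset.ne_of_mem_erase hs
      exact Fintype.prod_equiv (Equiv.mulLeft₀ s hs0) _ _ fun r => rfl
  have h4 := H.prod_mem (t := Finset.univ) (fun t _ => h1 t)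
  rw [h3] at h4
  exact (H.mul_mem_cancel_right (H.prod_mem fun s _ => h2 s)).1 h4

/-- In a finite nilpotent group, a supplement of the commutator is everything. -/
theorem cop_nilp_top {G : Type*} [Group G] [Finite G] [Group.IsNilpotent G] (H : Subgroup G)
    (h : H ⊔ commutator G = ⊤) : H = ⊤ := by
  by_contra hne
  obtain ⟨M, hM, hHM⟩ := (eq_top_or_exists_le_coatom H).resolve_left hne
  have : M.Normal := Subgroup.NormalizerCondition.normal_of_coatom M
    Group.normalizerCondition_of_isNilpotent hM
  have hc : commutator G ≤ M := by
    by_contra hcM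
    have hsup : M ⊔ commutator G = ⊤ := by
      rcases hM.le_iff.1 (le_sup_left : M ≤ M ⊔ commutator G) with h' | h'
      · exact h'
      · exact absurd (h' ▸ le_sup_right) hcM
    have : Nontrivial (G ⧸ M) := QuotientGroup.nontrivial_iff.2 hM.1
    have : Group.IsSolvable G := IsNilpotent.to_isSolvable
    have hlt := Group.IsSolvable.commutator_lt_top_of_nontrivial (G ⧸ M)
    apply hlt.ne
    have hm : (commutator G).map (QuotientGroup.mk' M) = commutator (G ⧸ M) := by
      rw [commutator_def, Subgroup.map_commutator, commutator_def,
        Subgroup.map_top_of_surjective _ (QuotientGroup.mk'_surjective M)]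
    have := congrArg (Subgroup.map (QuotientGroup.mk' M)) hsup
    rw [Subgroup.map_sup, QuotientGroup.map_mk'_self, bot_sup_eq, hm,
      Subgroup.map_top_of_surjective _ (QuotientGroup.mk'_surjective M)] at this
    exact this
  exact hM.1 (top_le_iff.1 (h ▸ sup_le hHM hc))

/-- The nilpotent case. -/
theorem cop_nilp {q : ℕ} (hq : q.Prime) {A : Type*} [Group A]
    (e : A ≃* Multiplicative (ZMod q × ZMod q)) (hA : IsPGroup q A)
    {G : Type*} [Group G] [Finite G] [Group.IsNilpotent G] [MulDistribMulAction A G]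
    (hcop : Nat.Coprime q (Nat.card G)) (H : Subgroup G)
    (hH : ∀ (a : A) (v : G), a ≠ 1 → a • v = v → v ∈ H) : H = ⊤ := by
  let : MulDistribMulAction A (Abelianization G) :=
    { smul := fun a x => Abelianization.map (MulDistribMulAction.toMonoidHom G a) x
      one_smul := by
        intro x
        induction x using QuotientGroup.induction_on with
        | H x => exact congrArg Abelianization.of (one_smul A x)
      mul_smul := by
        intro a b x
        induction x using QuotientGroup.induction_on with
        | H x => exact congrArg Abelianization.of (mul_smul a b x)
      smul_mul := fun a x y => map_mul _ x y
      smul_one := fun a => map_one _ }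
  have hf : ∀ (a : A) (g : G), Abelianization.of (a • g) = a • Abelianization.of g :=
    fun a g => rfl
  apply cop_nilp_top
  rw [eq_top_iff]
  intro g _
  have key := cop_abelian hq e (H.map Abelianization.of) (by
    intro a v ha hv
    obtain ⟨g, rfl⟩ : ∃ g, Abelianization.of g = v := QuotientGroup.mk_surjective v
    obtain ⟨g', h1, h2⟩ := cop_fixed_lift hq hA hcop Abelianization.of hf a g hv
    exact ⟨g', hH a g' ha h2, h1⟩) (Abelianization.of g)
  have hmem : g ^ q ∈ H ⊔ commutator G := by
    rw [← map_pow] at key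
    obtain ⟨x, hx, hxe⟩ := key
    have : x⁻¹ * g ^ q ∈ commutator G := by
      rw [← Abelianization.ker_of, MonoidHom.mem_ker, map_mul, map_inv, hxe, inv_mul_cancel]
    have h' := Subgroup.mul_mem _ (Subgroup.mem_sup_left (T := commutator G) hx)
      (Subgroup.mem_sup_right (S := H) this)
    simpa using h'
  have hz : Nat.Coprime (orderOf g) q :=
    (Nat.Coprime.coprime_dvd_right (orderOf_dvd_natCard g) hcop).symm
  obtain ⟨m, hm⟩ := exists_pow_eq_self_of_coprime hz.symm
  rw [← hm]
  exact Subgroup.pow_mem _ hmem m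

/-- If `A` is elementary abelian of order `q²` (`q` prime) acting coprimely on a
finite group `G`, then `G` is generated by the centralizers `C_G(a)`, `a ∈ A^#`. -/
theorem coprime_action_rank_two_generated_by_centralizers
    (q : ℕ) (hq : q.Prime) (A : Type*) [Group A]
    (hA : Nonempty (A ≃* Multiplicative (ZMod q × ZMod q)))
    (G : Type*) [Group G] [Finite G] [MulDistribMulAction A G]
    (hcop : Nat.Coprime q (Nat.card G)) :
    Subgroup.closure (⋃ a ∈ {a : A | a ≠ 1}, {g : G | a • g = g}) = ⊤ := by
  obtain ⟨e⟩ := hA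
  have : Fact q.Prime := ⟨hq⟩
  have hAp : IsPGroup q A := by
    apply IsPGroup.of_card (n := 2)
    rw [Nat.card_congr e.toEquiv, Nat.card_congr Multiplicative.toAdd, Nat.card_prod, Nat.card_zmod,
      sq]
  set H := Subgroup.closure (⋃ a ∈ {a : A | a ≠ 1}, {g : G | a • g = g}) with hHdef
  have hH : ∀ (a : A) (v : G), a ≠ 1 → a • v = v → v ∈ H := by
    intro a v ha hv
    apply Subgroup.subset_closure
    simp only [Set.mem_iUnion]
    exact ⟨a, ha, hv⟩
  have hSyl : ∀ p : ℕ, p.Prime → ∃ P : Sylow p G, (P : Subgroup G) ≤ H := by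
    intro p hp
    have : Fact p.Prime := ⟨hp⟩
    have hnd : ¬ q ∣ Nat.card (Sylow p G) := by
      intro hd
      have P0 : Sylow p G := default
      exact (Nat.Prime.coprime_iff_not_dvd hq).1 hcop
        (hd.trans (P0.card_dvd_index.trans (Subgroup.index_dvd_card _)))
    obtain ⟨P, hP⟩ := hAp.nonempty_fixed_point_of_prime_not_dvd_card (Sylow p G) hnd
    refine ⟨P, ?_⟩
    have hinv : ∀ (a : A) (x : G), x ∈ (P : Subgroup G) → a • x ∈ (P : Subgroup G) := by
      intro a x hx
      have h1 : a • (P : Subgroup G) = P := congrArg Sylow.toSubgroup (hP a)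
      rw [← h1]
      exact Subgroup.smul_mem_pointwise_smul x a _ hx
    let : MulDistribMulAction A (P : Subgroup G) :=
      { smul := fun a x => ⟨a • x.1, hinv a x.1 x.2⟩
        one_smul := fun x => Subtype.ext (one_smul A x.1)
        mul_smul := fun a b x => Subtype.ext (mul_smul a b x.1)
        smul_mul := fun a x y => Subtype.ext (smul_mul' a x.1 y.1)
        smul_one := fun a => Subtype.ext (smul_one a) }
    have : Group.IsNilpotent (P : Subgroup G) := P.2.isNilpotent
    have := cop_nilp hq e hAp
      (Nat.Coprime.coprime_dvd_right (Subgroup.card_subgroup_dvd_card (P : Subgroup G)) hcop)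
      (H.subgroupOf P) (fun a v ha hv => hH a v.1 ha (congrArg Subtype.val hv))
    exact Subgroup.subgroupOf_eq_top.1 this
  rw [← Subgroup.index_eq_one]
  by_contra hne
  obtain ⟨p, hp, hpd⟩ := Nat.exists_prime_and_dvd hne
  have : Fact p.Prime := ⟨hp⟩
  obtain ⟨P, hPH⟩ := hSyl p hp
  exact P.not_dvd_index (hpd.trans (Subgroup.index_dvd_of_le hPH))
end

section
/- Let P be a powerful finite p-group generated by d elements. Then every subgroup of P can be generated by at most d elements. -/
/-- The subgroup generated by all `n`-th powers. -/
def subgroupPow {P : Type*} [Group P] (H : Subgroup P) (n : ℕ) : Subgroup P :=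
  Subgroup.closure {x : P | ∃ h ∈ H, h ^ n = x}

namespace PowerfulRank

open Subgroup
open scoped commutatorElement

/-- Power formula in class two situation. -/
lemma mul_pow_class_two {Q : Type*} [Group Q] (x y z : Q) (hyx : y * x = x * y * z)
    (hzx : z * x = x * z) (hzy : z * y = y * z) (n : ℕ) :
    (x * y) ^ n = x ^ n * y ^ n * z ^ (n * (n - 1) / 2) := by
  have h1 : ∀ n : ℕ, y ^ n * x = x * y ^ n * z ^ n := by
    intro n
    induction n with
    | zero => simp
    | succ k ih =>
      have c : z ^ k * y = y * z ^ k := ((show Commute z y from hzy).pow_left k).eq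
      have c' : y * z ^ k = z ^ k * y := c.symm
      calc y ^ (k+1) * x = y * (y ^ k * x) := by rw [pow_succ']; group
        _ = (y * x) * y ^ k * z ^ k := by rw [ih]; group
        _ = x * y * (z * y ^ k) * z ^ k := by rw [hyx]; group
        _ = x * y * (y ^ k * z) * z ^ k := by
          rw [((show Commute z y from hzy).pow_right k).eq]
        _ = x * y ^ (k+1) * z ^ (k+1) := by rw [pow_succ' y, pow_succ' z]; group
  induction n with
  | zero => simp
  | succ k ih =>
    have e : (k + 1) * (k + 1 - 1) / 2 = k + k * (k - 1) / 2 := by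
      rw [← Finset.sum_range_id_mul_two k, ← Finset.sum_range_id_mul_two (k+1),
        Nat.mul_div_cancel _ two_pos, Nat.mul_div_cancel _ two_pos,
        Finset.sum_range_succ, add_comm]
    rw [pow_succ, ih, e]
    generalize k * (k - 1) / 2 = c
    have c1 : z ^ c * x = x * z ^ c := ((show Commute z x from hzx).pow_left c).eq
    have c2 : z ^ (k + c) * y = y * z ^ (k + c) := ((show Commute z y from hzy).pow_left _).eq
    calc x ^ k * y ^ k * z ^ c * (x * y) = x ^ k * y ^ k * (z ^ c * x) * y := by group
      _ = x ^ k * (y ^ k * x) * z ^ c * y := by rw [c1]; group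
      _ = x ^ k * x * y ^ k * (z ^ (k + c) * y) := by rw [h1, pow_add]; group
      _ = x ^ (k+1) * y ^ (k+1) * z ^ (k + c) := by rw [c2, pow_succ x, pow_succ y]; group

variable {P : Type*} [Group P]

lemma mul_pow_mod (p : ℕ) (hp : p.Prime) (N : Subgroup P) [N.Normal] (x y : P)
    (h1 : ∀ g, ⁅⁅y⁻¹, x⁻¹⁆, g⁆ ∈ N)
    (h2 : (p ≠ 2 ∧ ⁅y⁻¹, x⁻¹⁆ ^ p ∈ N) ∨ ⁅y⁻¹, x⁻¹⁆ ∈ N) :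
    ((x * y : P) : P ⧸ N) ^ p = (x : P ⧸ N) ^ p * (y : P ⧸ N) ^ p := by
  have hc : ∀ g : P, ((⁅y⁻¹, x⁻¹⁆ : P) : P ⧸ N) * (g : P ⧸ N) = g * ((⁅y⁻¹, x⁻¹⁆ : P) : P ⧸ N) := by
    intro g
    have := (QuotientGroup.eq_one_iff (N := N) _).2 (h1 g)
    rw [← commutatorElement_eq_one_iff_mul_comm]
    exact this
  have := mul_pow_class_two (x : P ⧸ N) (y : P ⧸ N) ((⁅y⁻¹, x⁻¹⁆ : P) : P ⧸ N)
    (by rw [← QuotientGroup.mk_mul, ← QuotientGroup.mk_mul, ← QuotientGroup.mk_mul]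
        congr 1
        rw [commutatorElement_def]; group) (hc x) (hc y) p
  rw [QuotientGroup.mk_mul, this]
  have hz : ((⁅y⁻¹, x⁻¹⁆ : P) : P ⧸ N) ^ (p * (p - 1) / 2) = 1 := by
    rcases h2 with ⟨h2, h3⟩ | h2
    · have h3' := (QuotientGroup.eq_one_iff (N := N) _).2 h3
      obtain ⟨k, hk⟩ := (hp.odd_of_ne_two h2)
      have : p * (p - 1) / 2 = p * k := by
        rw [hk, Nat.add_sub_cancel, show (2*k+1)*(2*k) = (2*k+1)*k*2 by ring,
          Nat.mul_div_cancel _ two_pos]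
      rw [this, pow_mul, ← QuotientGroup.mk_pow, h3', one_pow]
    · rw [(QuotientGroup.eq_one_iff (N := N) _).2 h2, one_pow]
  rw [hz, mul_one]

/-- lower `p`-series -/
def ser (P : Type*) [Group P] (p : ℕ) : ℕ → Subgroup P
  | 0 => ⊤
  | n + 1 => subgroupPow (ser P p n) p ⊔ ⁅ser P p n, (⊤ : Subgroup P)⁆

/-- concrete Frattini subgroup -/
def phi (p : ℕ) (H : Subgroup P) : Subgroup P := subgroupPow H p ⊔ ⁅H, H⁆

lemma pow_mem_subgroupPow {H : Subgroup P} {x : P} (hx : x ∈ H) (n : ℕ) :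
    x ^ n ∈ subgroupPow H n := subset_closure ⟨x, hx, rfl⟩

lemma subgroupPow_le {H K : Subgroup P} {n : ℕ} (h : ∀ x ∈ H, x ^ n ∈ K) :
    subgroupPow H n ≤ K := by
  rw [subgroupPow, closure_le]
  rintro _ ⟨x, hx, rfl⟩
  exact h x hx

lemma subgroupPow_mono {H K : Subgroup P} (h : H ≤ K) (n : ℕ) :
    subgroupPow H n ≤ subgroupPow K n :=
  subgroupPow_le fun _ hx => pow_mem_subgroupPow (h hx) n

lemma relIndex_ne_zero' [Finite P] {H K : Subgroup P} : H.relIndex K ≠ 0 :=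
  index_ne_zero_of_finite

lemma phi_mono {H K : Subgroup P} (h : H ≤ K) (p : ℕ) : phi p H ≤ phi p K :=
  sup_le_sup (subgroupPow_mono h p) (commutator_mono h h)

lemma phi_le_self (H : Subgroup P) (p : ℕ) : phi p H ≤ H :=
  sup_le (subgroupPow_le fun _ hx => H.pow_mem hx p) (commutator_le_self H)

instance subgroupPow_normal (H : Subgroup P) [hH : H.Normal] (n : ℕ) : (subgroupPow H n).Normal := by
  constructor
  intro x hx g
  have : subgroupPow H n ≤ (subgroupPow H n).comap (MulAut.conj g).toMonoidHom := by
    refine subgroupPow_le fun x hx => ?_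
    rw [mem_comap, map_pow]
    exact pow_mem_subgroupPow (hH.conj_mem x hx g) n
  exact this hx

instance ser_normal (p n : ℕ) : (ser P p n).Normal := by
  induction n with
  | zero => rw [ser]; infer_instance
  | succ k ih => rw [ser]; infer_instance

lemma pow_mem_ser {p n : ℕ} {x : P} (hx : x ∈ ser P p n) : x ^ p ∈ ser P p (n+1) :=
  mem_sup_left (pow_mem_subgroupPow hx p)

lemma comm_le_ser (p n : ℕ) : ⁅ser P p n, (⊤ : Subgroup P)⁆ ≤ ser P p (n+1) := by
  rw [ser]; exact le_sup_right

lemma comm_mem_ser {p n : ℕ} {x : P} (hx : x ∈ ser P p n) (g : P) : ⁅x, g⁆ ∈ ser P p (n+1) :=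
  comm_le_ser p n (commutator_mem_commutator hx (mem_top g))

lemma ser_succ_le (p n : ℕ) : ser P p (n+1) ≤ ser P p n :=
  sup_le (subgroupPow_le fun _ hx => Subgroup.pow_mem _ hx p) (commutator_le_left _ _)

lemma phi_ser_le {p n : ℕ} {H : Subgroup P} (h : H ≤ ser P p n) : phi p H ≤ ser P p (n+1) :=
  sup_le_sup (subgroupPow_mono h p) (commutator_mono h le_top)

lemma comm_le_iff {N A : Subgroup P} [N.Normal] :
    ⁅A, (⊤ : Subgroup P)⁆ ≤ N ↔ A ≤ (center (P ⧸ N)).comap (QuotientGroup.mk' N) := by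
  rw [commutator_le]
  constructor
  · intro h x hx
    rw [mem_comap, mem_center_iff]
    intro g
    obtain ⟨g, rfl⟩ := QuotientGroup.mk_surjective g
    have := (QuotientGroup.eq_one_iff (N := N) _).2 (h x hx g (mem_top _))
    symm
    rw [← commutatorElement_eq_one_iff_mul_comm]
    exact this
  · intro h x hx g _
    have := h hx
    rw [mem_comap, mem_center_iff] at this
    have := this g
    symm at this
    rw [← commutatorElement_eq_one_iff_mul_comm] at this
    exact (QuotientGroup.eq_one_iff (N := N) _).1 this

/-- `p`-th powers become central. -/
lemma pow_central (p : ℕ) (hp : p.Prime) (N : Subgroup P) [N.Normal] (x : P)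
    (h0 : ∀ g : P, ⁅x⁻¹, g⁆ ^ p ∈ N)
    (h1 : ∀ g g' : P, ⁅⁅⁅x⁻¹, g⁆⁻¹, x⁻¹⁆, g'⁆ ∈ N)
    (h2 : ∀ g : P, (p ≠ 2 ∧ ⁅⁅x⁻¹, g⁆⁻¹, x⁻¹⁆ ^ p ∈ N) ∨ ⁅⁅x⁻¹, g⁆⁻¹, x⁻¹⁆ ∈ N) :
    x ^ p ∈ (center (P ⧸ N)).comap (QuotientGroup.mk' N) := by
  rw [mem_comap, mem_center_iff]
  intro g
  obtain ⟨g, rfl⟩ := QuotientGroup.mk_surjective g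
  have h := mul_pow_mod p hp N x ⁅x⁻¹, g⁆ (h1 g) (h2 g)
  have h3 := (QuotientGroup.eq_one_iff (N := N) _).2 (h0 g)
  rw [QuotientGroup.mk_pow] at h3
  rw [h3, mul_one, show x * ⁅x⁻¹, g⁆ = g * x * g⁻¹ by rw [commutatorElement_def]; group,
    ← QuotientGroup.mk_pow, conj_pow] at h
  rw [QuotientGroup.mk'_apply, QuotientGroup.mk_pow]
  nth_rewrite 2 [← h]
  rw [← QuotientGroup.mk_pow, ← QuotientGroup.mk_mul, ← QuotientGroup.mk_mul]
  congr 1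
  group

lemma even_step (hpow : ⁅(⊤ : Subgroup P), (⊤ : Subgroup P)⁆ ≤ subgroupPow ⊤ 4) (n : ℕ) :
    ⁅ser P 2 n, (⊤ : Subgroup P)⁆ ≤ ser P 2 (n+2) := by
  induction n with
  | zero =>
    refine le_trans hpow (subgroupPow_le fun x hx => ?_)
    have h1 : x ∈ ser P 2 0 := by rw [ser]; exact hx
    have := pow_mem_ser (pow_mem_ser h1)
    rwa [← pow_mul] at this
  | succ n ih =>
    rw [comm_le_iff]
    rw [show ser P 2 (n+1) = subgroupPow (ser P 2 n) 2 ⊔ ⁅ser P 2 n, (⊤ : Subgroup P)⁆ from rfl]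
    have hc : ∀ x ∈ ser P 2 n, ∀ g, ⁅x, g⁆ ∈ ser P 2 (n+2) := fun x hx g =>
      ih (commutator_mem_commutator hx (mem_top g))
    refine sup_le (subgroupPow_le fun x hx => ?_) (ih.trans ?_)
    · refine pow_central 2 Nat.prime_two _ x (fun g => pow_mem_ser (hc _ (inv_mem hx) g)) ?_ ?_
      · intro g g'
        exact ser_succ_le _ _ (comm_mem_ser (comm_mem_ser (inv_mem (hc _ (inv_mem hx) g)) _) _)
      · intro g
        exact Or.inr (comm_mem_ser (inv_mem (hc _ (inv_mem hx) g)) _)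
    · rw [← comm_le_iff]; exact comm_le_ser _ _

lemma main_step (p : ℕ) (hp : p.Prime)
    (hpow : ⁅(⊤ : Subgroup P), (⊤ : Subgroup P)⁆ ≤ subgroupPow ⊤ (if p = 2 then 4 else p)) (n : ℕ) :
    ⁅ser P p n, (⊤ : Subgroup P)⁆ ≤ subgroupPow (ser P p n) p ⊔ ser P p (n+2) := by
  by_cases h2 : p = 2
  · subst h2
    exact (even_step (by simpa using hpow) n).trans le_sup_right
  rw [if_neg h2] at hpow
  induction n with
  | zero => exact hpow.trans le_sup_left
  | succ n ih =>
    rw [comm_le_iff]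
    have hle : ser P p (n+1) ≤ subgroupPow (ser P p n) p ⊔ ser P p (n+2) := by
      rw [show ser P p (n+1) = subgroupPow (ser P p n) p ⊔ ⁅ser P p n, (⊤ : Subgroup P)⁆ from rfl]
      exact sup_le le_sup_left ih
    refine hle.trans (sup_le (subgroupPow_le fun x hx => ?_) ?_)
    · refine pow_central p hp _ x
        (fun g => mem_sup_left (pow_mem_subgroupPow (comm_mem_ser (inv_mem hx) g) p)) ?_ ?_
      · intro g g'
        exact mem_sup_right
          (comm_mem_ser (comm_mem_ser (inv_mem (comm_mem_ser (inv_mem hx) g)) _) _)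
      · intro g
        exact Or.inl ⟨h2, mem_sup_right
          (pow_mem_ser (comm_mem_ser (inv_mem (comm_mem_ser (inv_mem hx) g)) _))⟩
    · rw [← comm_le_iff]; exact (comm_le_ser _ _).trans le_sup_right

lemma ser_succ_eq (p : ℕ) (hp : p.Prime)
    (hpow : ⁅(⊤ : Subgroup P), (⊤ : Subgroup P)⁆ ≤ subgroupPow ⊤ (if p = 2 then 4 else p)) (n : ℕ) :
    ser P p (n+1) ≤ subgroupPow (ser P p n) p ⊔ ser P p (n+2) := by
  rw [show ser P p (n+1) = subgroupPow (ser P p n) p ⊔ ⁅ser P p n, (⊤ : Subgroup P)⁆ from rfl]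
  exact sup_le le_sup_left (main_step p hp hpow n)

lemma ser_mul_pow (p : ℕ) (hp : p.Prime)
    (hpow : ⁅(⊤ : Subgroup P), (⊤ : Subgroup P)⁆ ≤ subgroupPow ⊤ (if p = 2 then 4 else p)) (n : ℕ)
    (x y : P) (hy : y ∈ ser P p n) :
    ((x * y : P) : P ⧸ ser P p (n+2)) ^ p =
      (x : P ⧸ ser P p (n+2)) ^ p * (y : P ⧸ ser P p (n+2)) ^ p := by
  have hz := comm_mem_ser (inv_mem hy) x⁻¹
  refine mul_pow_mod p hp _ x y (fun g => comm_mem_ser hz g) ?_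
  by_cases h2 : p = 2
  · subst h2
    exact Or.inr (even_step (by simpa using hpow) n
      (commutator_mem_commutator (inv_mem hy) (mem_top _)))
  · exact Or.inl ⟨h2, pow_mem_ser hz⟩

/-- Termination. -/
lemma eq_bot_of_le (p : ℕ) (G : Type*) [Group G] [Group.IsNilpotent G] :
    (∃ k, ∀ g : G, g ^ p ^ k = 1) → ∀ N : Subgroup G, N ≤ subgroupPow N p ⊔ ⁅N, (⊤ : Subgroup G)⁆ → N = ⊥ := by
  apply Group.nilpotent_center_quotient_ind
    (P := fun G _ _ => (∃ k, ∀ g : G, g ^ p ^ k = 1) → ∀ N : Subgroup G,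
      N ≤ subgroupPow N p ⊔ ⁅N, (⊤ : Subgroup G)⁆ → N = ⊥) G
  · intro G _ _ _ N _
    exact Subsingleton.elim _ _
  · intro G _ _ ih hG N hN
    have h1 : N.map (QuotientGroup.mk' (center G)) = ⊥ := by
      apply ih (by
        obtain ⟨k, hk⟩ := hG
        refine ⟨k, fun g => ?_⟩
        obtain ⟨g, rfl⟩ := QuotientGroup.mk_surjective g
        rw [← QuotientGroup.mk_pow, hk, QuotientGroup.mk_one])
      have := map_mono (f := QuotientGroup.mk' (center G)) hN
      refine this.trans ?_
      rw [Subgroup.map_sup, map_commutator]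
      refine sup_le_sup ?_ (commutator_mono le_rfl le_top)
      rw [Subgroup.map_le_iff_le_comap]
      refine subgroupPow_le fun x hx => ?_
      rw [mem_comap, map_pow]
      exact pow_mem_subgroupPow (mem_map_of_mem _ hx) p
    have h2 : N ≤ center G := by
      rw [(N.map_eq_bot_iff), QuotientGroup.ker_mk'] at h1
      exact h1
    have h3 : ⁅N, (⊤ : Subgroup G)⁆ = ⊥ := by
      rw [eq_bot_iff, commutator_le]
      intro x hx g _
      rw [mem_bot, commutatorElement_eq_one_iff_mul_comm]
      exact ((mem_center_iff.1 (h2 hx)) g).symm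
    rw [h3, sup_bot_eq] at hN
    have h4 : ∀ k : ℕ, ∀ x ∈ N, ∃ y ∈ N, y ^ p ^ k = x := by
      have h5 : ∀ x ∈ N, ∃ y ∈ N, y ^ p = x := by
        intro x hx
        have := hN hx
        rw [subgroupPow] at this
        induction this using closure_induction with
        | mem x hm => exact hm
        | one => exact ⟨1, N.one_mem, one_pow _⟩
        | mul a b ha hb iha ihb =>
          have ha' : a ∈ N := (subgroupPow_le (H := N) (fun x hx => N.pow_mem hx p)) ha
          have hb' : b ∈ N := (subgroupPow_le (H := N) (fun x hx => N.pow_mem hx p)) hb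
          obtain ⟨c, hc, rfl⟩ := iha ha'
          obtain ⟨d, hd, rfl⟩ := ihb hb'
          refine ⟨c * d, N.mul_mem hc hd, ?_⟩
          exact (show Commute c d from ((mem_center_iff.1 (h2 hc)) d).symm).mul_pow p
        | inv a ha iha =>
          obtain ⟨c, hc, hca⟩ := iha ((inv_mem_iff (H := N)).1 hx)
          exact ⟨c⁻¹, N.inv_mem hc, by rw [inv_pow, hca]⟩
      intro k
      induction k with
      | zero => intro x hx; exact ⟨x, hx, by simp⟩
      | succ k ihk =>
        intro x hx
        obtain ⟨y, hy, rfl⟩ := ihk x hx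
        obtain ⟨z, hz, rfl⟩ := h5 y hy
        exact ⟨z, hz, by rw [pow_succ', pow_mul]⟩
    rw [eq_bot_iff]
    intro x hx
    obtain ⟨k, hk⟩ := hG
    obtain ⟨y, -, rfl⟩ := h4 k x hx
    rw [hk]
    exact one_mem _

lemma eq_bot_of_le' (p : ℕ) (hp : p.Prime) (G : Type*) [Group G] [Finite G] (hG : IsPGroup p G)
    (N : Subgroup G) (hN : N ≤ subgroupPow N p ⊔ ⁅N, (⊤ : Subgroup G)⁆) : N = ⊥ := by
  have : Fact p.Prime := ⟨hp⟩
  have := hG.isNilpotent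
  exact eq_bot_of_le p G (isPGroup_iff_exists_pow_pow_eq_one.1 hG) N hN

lemma ser_terminates (p : ℕ) (hp : p.Prime) [Finite P] (hP : IsPGroup p P) :
    ∃ n, ser P p n = ⊥ := by
  obtain ⟨n, hn⟩ := WellFoundedGT.monotone_chain_condition
    (α := (Subgroup P)ᵒᵈ) ⟨fun n => OrderDual.toDual (ser P p n),
      monotone_nat_of_le_succ fun n => ser_succ_le p n⟩
  refine ⟨n, eq_bot_of_le' p hp P hP _ ?_⟩
  have : ser P p n = ser P p (n+1) := hn (n+1) (Nat.le_succ n)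
  exact this.le

lemma nongen (p : ℕ) (hp : p.Prime) [Finite P] (hP : IsPGroup p P) (U : Subgroup P)
    (hU : U ⊔ phi p ⊤ = ⊤) : U = ⊤ := by
  have : Fact p.Prime := ⟨hp⟩
  have := hP.isNilpotent
  apply frattini_nongenerating
  rw [eq_top_iff, ← hU]
  refine sup_le_sup le_rfl ?_
  rw [frattini, Order.radical]
  refine le_iInf₂ fun M hM => ?_
  have hn : M.Normal := Group.normalizerCondition_of_isNilpotent.normal_of_coatom M hM
  by_contra hle
  have htop : M ⊔ phi p ⊤ = ⊤ := hM.2 _ (left_lt_sup.2 hle)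
  have h1 := congrArg (Subgroup.map (QuotientGroup.mk' M)) htop
  rw [Subgroup.map_sup, QuotientGroup.map_mk'_self, bot_sup_eq,
    Subgroup.map_top_of_surjective _ (QuotientGroup.mk'_surjective M)] at h1
  have h2 : (⊤ : Subgroup (P ⧸ M)) = ⊥ := by
    apply eq_bot_of_le' p hp _ (hP.to_quotient M)
    nth_rewrite 1 [← h1]
    rw [phi, Subgroup.map_sup, map_commutator]
    refine sup_le_sup ?_ (commutator_mono le_top le_top)
    rw [Subgroup.map_le_iff_le_comap]
    refine subgroupPow_le fun x hx => ?_
    rw [mem_comap, map_pow]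
    exact pow_mem_subgroupPow (mem_top _) p
  apply hM.1
  rw [eq_top_iff]
  intro x _
  have : (x : P ⧸ M) ∈ (⊥ : Subgroup (P ⧸ M)) := h2 ▸ mem_top _
  exact (QuotientGroup.eq_one_iff _).1 (mem_bot.1 this)

lemma exists_gen (p : ℕ) (hp : p.Prime) [Finite P] (hP : IsPGroup p P) (d : ℕ) :
    ∀ K : Subgroup P, K.index ≤ p ^ d →
      ∃ T : Finset P, T.card ≤ d ∧ K ⊔ Subgroup.closure (T : Set P) = ⊤ := by
  classical
  have : Fact p.Prime := ⟨hp⟩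
  induction d with
  | zero =>
    intro K hK
    refine ⟨∅, le_rfl, ?_⟩
    have h0 : K.index ≠ 0 := index_ne_zero_of_finite
    have : K.index = 1 := by rw [pow_zero] at hK; omega
    rw [index_eq_one.1 this, top_sup_eq]
  | succ d ih =>
    intro K hK
    by_cases h : K = ⊤
    · exact ⟨∅, by simp, by rw [h, top_sup_eq]⟩
    obtain ⟨x, hx⟩ : ∃ x, x ∉ K := by
      by_contra! hc
      exact h (eq_top_iff.2 fun x _ => hc x)
    set K' := K ⊔ Subgroup.closure {x} with hK'
    have hle : K ≤ K' := le_sup_left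
    have h1 := relIndex_mul_index hle
    have h2 : p ≤ K.relIndex K' := by
      obtain ⟨m, hm⟩ := (hP.to_subgroup K').index (K.subgroupOf K')
      change K.relIndex K' = _ at hm
      rw [hm]
      have : m ≠ 0 := by
        rintro rfl
        rw [pow_zero, relIndex_eq_one] at hm
        exact hx (hm (mem_sup_right (subset_closure rfl)))
      exact Nat.le_self_pow this p
    obtain ⟨T, hT, hT'⟩ := ih K' (by
      rw [← h1, pow_succ'] at hK
      exact Nat.le_of_mul_le_mul_left ((Nat.mul_le_mul_right _ h2).trans hK) hp.pos)
    refine ⟨insert x T, (Finset.card_insert_le _ _).trans (by omega), ?_⟩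
    rw [Finset.coe_insert, Set.insert_eq, Subgroup.closure_union, ← sup_assoc]
    exact hT'

lemma exists_gen_subgroup (p : ℕ) (hp : p.Prime) [Finite P] (hP : IsPGroup p P) (d : ℕ)
    (H : Subgroup P) (hH : (phi p H).relIndex H ≤ p ^ d) :
    ∃ T : Finset P, T.card ≤ d ∧ Subgroup.closure (T : Set P) = H := by
  classical
  have hphi : (phi p (⊤ : Subgroup H)) = (phi p H).subgroupOf H := by
    apply Subgroup.map_injective H.subtype_injective
    rw [subgroupOf_map_subtype, inf_eq_left.2 (phi_le_self H p), phi, Subgroup.map_sup,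
      map_commutator, phi, ← MonoidHom.range_eq_map, H.range_subtype]
    congr 1
    apply le_antisymm
    · rw [Subgroup.map_le_iff_le_comap]
      refine subgroupPow_le fun x hx => ?_
      rw [mem_comap, map_pow]
      exact pow_mem_subgroupPow x.2 p
    · refine subgroupPow_le fun x hx => ⟨⟨x, hx⟩ ^ p, pow_mem_subgroupPow (mem_top _) p, rfl⟩
  obtain ⟨T, hT, hT'⟩ := exists_gen p hp (hP.to_subgroup H) d (phi p ⊤) (by rw [hphi]; exact hH)
  rw [sup_comm] at hT'
  have := nongen p hp (hP.to_subgroup H) _ hT'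
  refine ⟨T.image H.subtype, Finset.card_image_le.trans hT, ?_⟩
  rw [Finset.coe_image, ← MonoidHom.map_closure, this, ← MonoidHom.range_eq_map, H.range_subtype]

lemma index_le (p : ℕ) (hp : p.Prime) [Finite P] (S : Finset P)
    (hgen : Subgroup.closure (S : Set P) = ⊤) : (ser P p 1).index ≤ p ^ S.card := by
  classical
  have hc : ∀ a b : P ⧸ ser P p 1, a * b = b * a := by
    intro a b
    obtain ⟨a, rfl⟩ := QuotientGroup.mk_surjective a
    obtain ⟨b, rfl⟩ := QuotientGroup.mk_surjective b
    rw [← commutatorElement_eq_one_iff_mul_comm]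
    exact (QuotientGroup.eq_one_iff _).2 (comm_mem_ser (n := 0) (mem_top a) b)
  let _ : CommGroup (P ⧸ ser P p 1) := { mul_comm := hc }
  have h := card_dvd_exponent_pow_rank' (P ⧸ ser P p 1) (n := p) (by
    intro g
    obtain ⟨g, rfl⟩ := QuotientGroup.mk_surjective g
    exact (QuotientGroup.eq_one_iff _).2 (pow_mem_ser (n := 0) (mem_top g)))
  have hr : Group.rank (P ⧸ ser P p 1) ≤ S.card := by
    refine (Group.rank_le (S := S.image (QuotientGroup.mk' (ser P p 1))) ?_).trans
      Finset.card_image_le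
    rw [Finset.coe_image, ← MonoidHom.map_closure, hgen,
      Subgroup.map_top_of_surjective _ (QuotientGroup.mk'_surjective _)]
  exact (Nat.le_of_dvd (pow_pos hp.pos _) h).trans (Nat.pow_le_pow_right hp.pos hr)

lemma rank_step [Finite P] (A B C H F F' : Subgroup P) [C.Normal] (p : ℕ)
    (hBA : B ≤ A) (hCB : C ≤ B) (hH : H ≤ A)
    (hA : ∀ x ∈ A, x ^ p ∈ B) (hB : ∀ x ∈ B, x ^ p ∈ C)
    (hmul : ∀ x ∈ A, ∀ y ∈ A, ((x * y : P) : P ⧸ C) ^ p = (x : P ⧸ C) ^ p * (y : P ⧸ C) ^ p)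
    (hsurj : B ≤ subgroupPow A p ⊔ C)
    (hF : ∀ x ∈ H, x ^ p ∈ F) (hFK : F ≤ H ⊓ B) (hF'F : F' ≤ F) (hF'C : F' ≤ C)
    (ih : F'.relIndex (H ⊓ B) ≤ C.relIndex B) :
    F.relIndex H ≤ B.relIndex A := by
  let f : A →* P ⧸ C :=
    { toFun := fun a => ((a : P) : P ⧸ C) ^ p
      map_one' := by simp
      map_mul' := fun a b => hmul a a.2 b b.2 }
  have hf : ∀ a : A, f a = QuotientGroup.mk' C ((a : P) ^ p) := fun a => rfl
  have hrange : f.range = B.map (QuotientGroup.mk' C) := by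
    apply le_antisymm
    · rintro _ ⟨a, rfl⟩
      exact ⟨_, hA a a.2, (hf a).symm⟩
    · rw [Subgroup.map_le_iff_le_comap]
      refine hsurj.trans (sup_le (subgroupPow_le fun x hx => ⟨⟨x, hx⟩, hf _⟩) ?_)
      intro x hx
      rw [mem_comap, QuotientGroup.mk'_apply, (QuotientGroup.eq_one_iff x).2 hx]
      exact one_mem _
  set D := f.ker.map A.subtype with hD
  have hDA : D ≤ A := by rw [hD]; exact map_subtype_le _
  have hDs : D.subgroupOf A = f.ker := by
    rw [hD]; exact comap_map_eq_self_of_injective A.subtype_injective f.ker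
  have hBD : B ≤ D := by
    intro x hx
    refine ⟨⟨x, hBA hx⟩, ?_, rfl⟩
    rw [SetLike.mem_coe, MonoidHom.mem_ker, hf]
    exact (QuotientGroup.eq_one_iff _).2 (hB x hx)
  have e1 : D.relIndex A = C.relIndex B := by
    rw [relIndex, hDs, index_ker, hrange, ← relIndex_ker, QuotientGroup.ker_mk']
  have e2 : D.relIndex H ≤ C.relIndex F := by
    rw [← relIndex_subgroupOf hH, hDs, relIndex_ker]
    have : C.relIndex F = Nat.card (F.map (QuotientGroup.mk' C)) := by
      rw [← relIndex_ker, QuotientGroup.ker_mk']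
    rw [this]
    apply Nat.card_mono (Set.toFinite _)
    rintro _ ⟨a, ha, rfl⟩
    exact ⟨_, hF _ ha, (hf a).symm⟩
  have e3 : B.relIndex A = B.relIndex D * D.relIndex A := (relIndex_mul_relIndex _ _ _ hBD hDA).symm
  have e4 : B.relIndex H ≤ B.relIndex D * D.relIndex H := by
    have := relIndex_inf_mul_relIndex B D H
    rw [inf_eq_left.2 hBD] at this
    rw [← this]
    exact Nat.mul_le_mul_right _ (relIndex_le_of_le_right inf_le_left relIndex_ne_zero')
  have e5 : F.relIndex H = F.relIndex (H ⊓ B) * B.relIndex H := by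
    rw [← relIndex_mul_relIndex F (H ⊓ B) H hFK inf_le_left, inf_relIndex_left]
  have e6 : F'.relIndex (H ⊓ B) = F'.relIndex F * F.relIndex (H ⊓ B) :=
    (relIndex_mul_relIndex _ _ _ hF'F hFK).symm
  have e7 : C.relIndex F ≤ F'.relIndex F := relIndex_le_of_le_left hF'C relIndex_ne_zero'
  have pos : 0 < C.relIndex F := Nat.pos_of_ne_zero relIndex_ne_zero'
  rw [e6] at ih
  rw [e5, e3, e1]
  refine Nat.le_of_mul_le_mul_left ?_ pos
  calc C.relIndex F * (F.relIndex (H ⊓ B) * B.relIndex H)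
      = (C.relIndex F * F.relIndex (H ⊓ B)) * B.relIndex H := by ring
    _ ≤ C.relIndex B * (B.relIndex D * C.relIndex F) :=
        Nat.mul_le_mul ((Nat.mul_le_mul_right _ e7).trans ih)
          (e4.trans (Nat.mul_le_mul_left _ e2))
    _ = _ := by ring

lemma rank_bound (p : ℕ) (hp : p.Prime) [Finite P] (hP : IsPGroup p P)
    (hpow : ⁅(⊤ : Subgroup P), (⊤ : Subgroup P)⁆ ≤ subgroupPow ⊤ (if p = 2 then 4 else p)) (n : ℕ)
    (H : Subgroup P) (hH : H ≤ ser P p n) :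
    (phi p H).relIndex H ≤ (ser P p (n+1)).relIndex (ser P p n) := by
  obtain ⟨m, hm⟩ := ser_terminates p hp hP
  have key : ∀ k n : ℕ, m ≤ n + k → ∀ H : Subgroup P, H ≤ ser P p n →
      (phi p H).relIndex H ≤ (ser P p (n+1)).relIndex (ser P p n) := by
    intro k
    induction k with
    | zero =>
      intro n hn H hH
      have : ser P p n ≤ ⊥ := by
        rw [← hm]
        exact antitone_nat_of_succ_le (ser_succ_le p) hn
      have hb : H = ⊥ := le_bot_iff.1 (hH.trans this)
      rw [hb, relIndex_bot_right]
      exact Nat.pos_of_ne_zero relIndex_ne_zero'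
    | succ k ih =>
      intro n hn H hH
      exact rank_step (ser P p n) (ser P p (n+1)) (ser P p (n+2)) H (phi p H)
        (phi p (H ⊓ ser P p (n+1))) p (ser_succ_le _ _) (ser_succ_le _ _) hH
        (fun x hx => pow_mem_ser hx) (fun x hx => pow_mem_ser hx)
        (fun x _ y hy => ser_mul_pow p hp hpow n x y hy) (ser_succ_eq p hp hpow n)
        (fun x hx => mem_sup_left (pow_mem_subgroupPow hx p))
        (le_inf (phi_le_self H p) (phi_ser_le hH)) (phi_mono inf_le_left p)
        (phi_ser_le inf_le_right)
        (ih (n+1) (by omega) _ inf_le_right)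
  exact key m n (by omega) H hH

end PowerfulRank

/-- In a powerful finite `p`-group generated by `d` elements, every subgroup can
be generated by at most `d` elements. -/
theorem powerful_subgroup_rank_le
    (p : ℕ) (hp : p.Prime)
    (P : Type*) [Group P] [Finite P] (hP : IsPGroup p P)
    (hpowerful : ⁅(⊤ : Subgroup P), (⊤ : Subgroup P)⁆ ≤
      subgroupPow ⊤ (if p = 2 then 4 else p))
    (d : ℕ) (S : Finset P) (hS : S.card = d) (hgen : Subgroup.closure (S : Set P) = ⊤) :
    ∀ H : Subgroup P, ∃ T : Finset P, T.card ≤ d ∧ Subgroup.closure (T : Set P) = H := by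
  intro H
  apply PowerfulRank.exists_gen_subgroup p hp hP d H
  have h1 := PowerfulRank.rank_bound p hp hP hpowerful 0 H le_top
  have h2 := PowerfulRank.index_le p hp S hgen
  rw [hS] at h2
  refine h1.trans ?_
  rw [PowerfulRank.ser, Subgroup.relIndex_top_right]
  exact h2
end
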